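/- Let ρ≥1 and η>0. Let X₀ and Z be independent real random variables such that E[|X₀|^ρ]<∞ and Z has density p_Z(x)=(1/2)e^{−|x|} with respect to Lebesgue measure. Then the law of X₀+ηZ belongs to 𝒫_ρ; in particular it has an almost everywhere positive density, a continuous increasing cumulative distribution function G with ∫|x|^ρ d(law of X₀+ηZ)<∞, and it satisfies, with c=1 and C=1/η: for all y>0, sup_x G(x+y)/G(x) ≤ e^{y/η} and sup_x (1−G)(x−y)/(1−G)(x) ≤ e^{y/η}. -/

import Mathlib

open MeasureTheory Set
open scoped ENNReal

/-- The density of the law of `η Z`, where `Z` has density `(1/2)e^{−|x|}`. -/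
noncomputable def laplaceKernel (η v : ℝ) : ℝ≥0∞ :=
  ENNReal.ofReal (η⁻¹ * ((1 / 2) * Real.exp (-|η⁻¹ * v|)))

lemma measurable_laplaceKernel (η : ℝ) : Measurable (laplaceKernel η) := by
  unfold laplaceKernel
  fun_prop

lemma laplaceKernel_pos {η : ℝ} (hη : 0 < η) (v : ℝ) : 0 < laplaceKernel η v := by
  unfold laplaceKernel
  rw [ENNReal.ofReal_pos]
  positivity

lemma laplaceKernel_add_le {η : ℝ} (hη : 0 < η) (v y : ℝ) :
    laplaceKernel η (v + y) ≤ ENNReal.ofReal (Real.exp (|y| / η)) * laplaceKernel η v := by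
  unfold laplaceKernel
  rw [← ENNReal.ofReal_mul (Real.exp_pos _).le]
  apply ENNReal.ofReal_le_ofReal
  have h : Real.exp (-|η⁻¹ * (v + y)|) ≤ Real.exp (|y| / η) * Real.exp (-|η⁻¹ * v|) := by
    rw [← Real.exp_add, Real.exp_le_exp]
    have h1 : |η⁻¹ * v| ≤ |η⁻¹ * (v + y)| + |η⁻¹ * y| := by
      have := abs_sub (η⁻¹ * (v + y)) (η⁻¹ * y)
      rwa [← mul_sub, add_sub_cancel_right] at this
    have h2 : |η⁻¹ * y| = |y| / η := by
      rw [abs_mul, abs_of_pos (inv_pos.2 hη), div_eq_inv_mul]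
    linarith
  calc η⁻¹ * (1 / 2 * Real.exp (-|η⁻¹ * (v + y)|))
      ≤ η⁻¹ * (1 / 2 * (Real.exp (|y| / η) * Real.exp (-|η⁻¹ * v|))) := by gcongr
    _ = _ := by ring

lemma integral_exp_neg_abs_eq_two : ∫ x : ℝ, Real.exp (-|x|) = 2 := by
  rw [integral_comp_abs (f := fun x => Real.exp (-x)), integral_exp_neg_Ioi_zero, mul_one]

lemma integrable_rpow_abs_mul_exp_neg_abs {ρ : ℝ} (hρ : 0 ≤ ρ) :
    Integrable fun x : ℝ => |x| ^ ρ * Real.exp (-|x|) := by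
  apply Integrable.of_integral_ne_zero
  rw [integral_comp_abs (f := fun x => x ^ ρ * Real.exp (-x))]
  have h := Real.Gamma_eq_integral (s := ρ + 1) (by linarith)
  simp only [add_sub_cancel_right, mul_comm (Real.exp _)] at h
  rw [← h]
  have := Real.Gamma_pos_of_pos (s := ρ + 1) (by linarith)
  positivity

lemma isProbabilityMeasure_laplace :
    IsProbabilityMeasure
      (volume.withDensity fun x : ℝ => ENNReal.ofReal ((1 / 2) * Real.exp (-|x|))) := by
  constructor
  rw [withDensity_apply _ MeasurableSet.univ, Measure.restrict_univ,
    ← ofReal_integral_eq_lintegral_ofReal, integral_const_mul, integral_exp_neg_abs_eq_two]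
  · norm_num
  · refine (Integrable.of_integral_ne_zero ?_).const_mul _
    rw [integral_exp_neg_abs_eq_two]
    norm_num
  · exact Filter.Eventually.of_forall fun x => by positivity

lemma integrable_rpow_abs_laplace {ρ : ℝ} (hρ : 0 ≤ ρ) :
    Integrable (fun x => |x| ^ ρ)
      (volume.withDensity fun x : ℝ => ENNReal.ofReal ((1 / 2) * Real.exp (-|x|))) := by
  rw [integrable_withDensity_iff (by fun_prop)
    (Filter.Eventually.of_forall fun _ => ENNReal.ofReal_lt_top)]
  refine ((integrable_rpow_abs_mul_exp_neg_abs hρ).const_mul (1 / 2)).congr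
    (Filter.Eventually.of_forall fun x => ?_)
  dsimp only
  rw [ENNReal.toReal_ofReal (by positivity)]
  ring

lemma lintegral_laplace_comp_add_mul {η : ℝ} (hη : 0 < η) (x : ℝ) {φ : ℝ → ℝ≥0∞}
    (hφ : Measurable φ) :
    ∫⁻ z, φ (x + η * z)
        ∂(volume.withDensity fun x : ℝ => ENNReal.ofReal ((1 / 2) * Real.exp (-|x|))) =
      ∫⁻ u, laplaceKernel η (u - x) * φ u := by
  rw [lintegral_withDensity_eq_lintegral_mul _ (by fun_prop) (by fun_prop)]
  rw [← lintegral_add_left_eq_self (fun u => laplaceKernel η (u - x) * φ u) x]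
  have hmeas : Measurable fun w : ℝ =>
      ENNReal.ofReal ((1 / 2) * Real.exp (-|η⁻¹ * w|)) * φ (x + w) := by fun_prop
  have h := lintegral_map (μ := volume) hmeas (measurable_const_mul η)
  rw [Real.map_volume_mul_left hη.ne', lintegral_smul_measure] at h
  simp only [inv_mul_cancel_left₀ hη.ne'] at h
  simp only [Pi.mul_apply]
  rw [← h, smul_eq_mul, ← lintegral_const_mul _ hmeas]
  refine lintegral_congr fun w => ?_
  rw [← mul_assoc, laplaceKernel, abs_of_pos (inv_pos.2 hη), ENNReal.ofReal_mul (inv_pos.2 hη).le,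
    add_sub_cancel_left]

/-- The law of `X + η Z`, with `X` of law `P` and `Z` an independent Laplace variable,
has density `u ↦ ∫ laplaceKernel η (u - x) P(dx)`. -/
lemma map_prod_laplace_eq_withDensity {η : ℝ} (hη : 0 < η) (P : Measure ℝ)
    [IsProbabilityMeasure P] :
    ((P.prod (volume.withDensity fun x : ℝ => ENNReal.ofReal ((1 / 2) * Real.exp (-|x|)))).map
      fun q => q.1 + η * q.2) =
      volume.withDensity fun u => ∫⁻ x, laplaceKernel η (u - x) ∂P := by
  have := isProbabilityMeasure_laplace
  have hk := measurable_laplaceKernel η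
  ext A hA
  have hφ : Measurable (A.indicator (1 : ℝ → ℝ≥0∞)) := measurable_one.indicator hA
  rw [withDensity_apply _ hA, ← lintegral_indicator_one hA, lintegral_map hφ (by fun_prop),
    lintegral_prod _ (by fun_prop)]
  simp only [lintegral_laplace_comp_add_mul hη _ hφ]
  rw [lintegral_lintegral_swap (by fun_prop), ← lintegral_indicator hA]
  refine lintegral_congr fun u => ?_
  by_cases hu : u ∈ A <;> simp [hu]

lemma lintegral_laplaceKernel_add_le {η : ℝ} (hη : 0 < η) (P : Measure ℝ) (u y : ℝ) :
    ∫⁻ x, laplaceKernel η (u + y - x) ∂P ≤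
      ENNReal.ofReal (Real.exp (|y| / η)) * ∫⁻ x, laplaceKernel η (u - x) ∂P := by
  have hk := measurable_laplaceKernel η
  rw [← lintegral_const_mul _ (by fun_prop)]
  refine lintegral_mono fun x => ?_
  rw [add_sub_right_comm]
  exact laplaceKernel_add_le hη _ _

/-- A pointwise bound on the translates of a density passes to the translates of sets. -/
lemma withDensity_preimage_sub_le {g : ℝ → ℝ≥0∞} (hg : Measurable g) {K : ℝ≥0∞} {y : ℝ}
    (hK : ∀ u, g (u + y) ≤ K * g u) {A : Set ℝ} (hA : MeasurableSet A) :
    volume.withDensity g ((fun u => u - y) ⁻¹' A) ≤ K * volume.withDensity g A := by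
  have hA' : MeasurableSet ((fun u => u - y) ⁻¹' A) := hA.preimage (by fun_prop)
  rw [withDensity_apply _ hA', withDensity_apply _ hA, ← lintegral_const_mul _ hg,
    ← lintegral_indicator hA', ← lintegral_indicator hA,
    ← lintegral_add_right_eq_self _ y]
  refine lintegral_mono fun u => ?_
  by_cases hu : u ∈ A <;> simp [hu, hK]

lemma integrable_rpow_abs_map_add_mul {ρ : ℝ} (hρ : 1 ≤ ρ) (η : ℝ) {P R : Measure ℝ}
    [IsProbabilityMeasure P] [IsProbabilityMeasure R] (hP : Integrable (fun x => |x| ^ ρ) P)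
    (hR : Integrable (fun x => |x| ^ ρ) R) :
    Integrable (fun x => |x| ^ ρ) ((P.prod R).map fun q => q.1 + η * q.2) := by
  have h0 : 0 < ρ := by linarith
  have key : ∀ μ : Measure ℝ, Integrable (fun x => |x| ^ ρ) μ ↔ MemLp id (ENNReal.ofReal ρ) μ := by
    intro μ
    rw [← integrable_norm_rpow_iff aestronglyMeasurable_id (by simp [h0]) (by simp),
      ENNReal.toReal_ofReal h0.le]
    rfl
  rw [key] at hP hR ⊢
  rw [memLp_map_measure_iff aestronglyMeasurable_id (by fun_prop)]
  have h1 : MemLp (fun q : ℝ × ℝ => q.1) (ENNReal.ofReal ρ) (P.prod R) :=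
    hP.comp_measurePreserving measurePreserving_fst
  have h2 : MemLp (fun q : ℝ × ℝ => q.2) (ENNReal.ofReal ρ) (P.prod R) :=
    hR.comp_measurePreserving measurePreserving_snd
  exact h1.add (h2.const_mul η)

/-- A monotone function with values in `(-∞, 1]` and at most exponential growth on translates
is continuous. -/
lemma continuous_of_monotone_of_le_exp_mul {η : ℝ} {G : ℝ → ℝ} (hmono : Monotone G)
    (hle : ∀ x, G x ≤ 1) (hη : 0 < η)
    (hG : ∀ y : ℝ, 0 < y → ∀ x, G (x + y) ≤ Real.exp (y / η) * G x) : Continuous G := by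
  have hstep : ∀ a b, a ≤ b → |G b - G a| ≤ Real.exp (|b - a| / η) - 1 := by
    intro a b hab
    rcases hab.eq_or_lt with rfl | hlt
    · simp
    have h := hG (b - a) (by linarith) a
    rw [add_sub_cancel] at h
    have h1 : 1 ≤ Real.exp ((b - a) / η) :=
      Real.one_le_exp (div_nonneg (by linarith) hη.le)
    rw [abs_of_nonneg (sub_nonneg.2 (hmono hab)), abs_of_nonneg (sub_nonneg.2 hab)]
    nlinarith [hle a]
  rw [continuous_iff_continuousAt]
  intro x₀
  rw [ContinuousAt, tendsto_iff_dist_tendsto_zero]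
  have hlim : Filter.Tendsto (fun x => Real.exp (|x - x₀| / η) - 1) (nhds x₀) (nhds 0) := by
    have : Continuous fun x => Real.exp (|x - x₀| / η) - 1 := by fun_prop
    simpa using this.tendsto x₀
  refine squeeze_zero (fun _ => dist_nonneg) (fun x => ?_) hlim
  rw [Real.dist_eq]
  rcases le_total x₀ x with h | h
  · exact hstep x₀ x h
  · rw [abs_sub_comm, abs_sub_comm x]
    exact hstep x x₀ h

/-- regularization of an initial law: if `X₀` has finite `ρ`-moment and `Z`
has density `(1/2)e^{−|x|}`, independent of `X₀`, then the law `Q` of `X₀ + ηZ` belongs to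
`𝒫_ρ`: it has an a.e. positive density, its cdf `G` is continuous and increasing, it has a
finite `ρ`-moment, and it satisfies the tail-domination bounds with `c = 1`, `C = 1/η`. -/
theorem stmt17 (ρ η : ℝ) (hρ : 1 ≤ ρ) (hη : 0 < η)
    (P0 : Measure ℝ) [IsProbabilityMeasure P0]
    (hm : Integrable (fun x => |x| ^ ρ) P0)
    (μZ : Measure ℝ)
    (hμZ : μZ = volume.withDensity fun x => ENNReal.ofReal ((1 / 2) * Real.exp (-|x|)))
    (Q : Measure ℝ) (hQ : Q = (P0.prod μZ).map fun q => q.1 + η * q.2)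
    (G : ℝ → ℝ) (hG : ∀ x, G x = (Q (Iic x)).toReal) :
    (∃ g : ℝ → ℝ≥0∞, Q = volume.withDensity g ∧ ∀ᵐ x ∂volume, 0 < g x) ∧
    Continuous G ∧ StrictMono G ∧
    Integrable (fun x => |x| ^ ρ) Q ∧
    (∀ y : ℝ, 0 < y → ∀ x : ℝ,
      G (x + y) ≤ Real.exp (y / η) * G x ∧
      1 - G (x - y) ≤ Real.exp (y / η) * (1 - G x)) := by
  have hprobZ : IsProbabilityMeasure μZ := hμZ ▸ isProbabilityMeasure_laplace
  have hprobQ : IsProbabilityMeasure Q :=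
    hQ ▸ Measure.isProbabilityMeasure_map (by fun_prop)
  have hk := measurable_laplaceKernel η
  set g : ℝ → ℝ≥0∞ := fun u => ∫⁻ x, laplaceKernel η (u - x) ∂P0
  have hgm : Measurable g := by
    have : Measurable fun p : ℝ × ℝ => laplaceKernel η (p.1 - p.2) := by fun_prop
    exact this.lintegral_prod_right'
  have hQg : Q = volume.withDensity g := by
    rw [hQ, hμZ]
    exact map_prod_laplace_eq_withDensity hη P0
  have hgpos : ∀ u, 0 < g u := fun u => by
    change 0 < ∫⁻ x, laplaceKernel η (u - x) ∂P0
    rw [lintegral_pos_iff_support (by fun_prop)]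
    have : (Function.support fun x => laplaceKernel η (u - x)) = univ :=
      eq_univ_of_forall fun x => (laplaceKernel_pos hη _).ne'
    simp [this]
  have hmass : ∀ (y : ℝ) {A : Set ℝ}, MeasurableSet A →
      Q.real ((fun u => u - y) ⁻¹' A) ≤ Real.exp (|y| / η) * Q.real A := by
    intro y A hA
    have h := withDensity_preimage_sub_le hgm
      (fun u => lintegral_laplaceKernel_add_le hη P0 u y) hA
    rw [← hQg] at h
    have h' := ENNReal.toReal_mono (by finiteness) h
    rwa [ENNReal.toReal_mul, ENNReal.toReal_ofReal (Real.exp_pos _).le] at h'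
  have hGc : ∀ x, 1 - G x = Q.real (Ioi x) := fun x => by
    rw [← compl_Iic, probReal_compl_eq_one_sub measurableSet_Iic, hG]
    rfl
  have hbound : ∀ y : ℝ, 0 < y → ∀ x : ℝ,
      G (x + y) ≤ Real.exp (y / η) * G x ∧
      1 - G (x - y) ≤ Real.exp (y / η) * (1 - G x) := by
    intro y hy x
    constructor
    · have h := hmass y (measurableSet_Iic (a := x))
      rw [abs_of_pos hy, preimage_sub_const_Iic] at h
      rw [hG, hG]
      exact h
    · have h := hmass (-y) (measurableSet_Ioi (a := x))
      rw [abs_neg, abs_of_pos hy, preimage_sub_const_Ioi, ← sub_eq_add_neg] at h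
      rw [hGc, hGc]
      exact h
  have hstrict : StrictMono G := by
    intro a b hab
    have hpos : 0 < Q.real (Ioc a b) := by
      refine ENNReal.toReal_pos (fun h0 => ?_) (by finiteness)
      rw [hQg, withDensity_apply_eq_zero hgm] at h0
      have : {x | g x ≠ 0} ∩ Ioc a b = Ioc a b :=
        inter_eq_right.2 fun x _ => (hgpos x).ne'
      rw [this, Real.volume_Ioc, ENNReal.ofReal_eq_zero] at h0
      linarith
    have hunion : Q.real (Iic b) = Q.real (Iic a) + Q.real (Ioc a b) := by
      rw [← Iic_union_Ioc_eq_Iic hab.le,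
        measureReal_union (Iic_disjoint_Ioc le_rfl) measurableSet_Ioc]
    rw [hG, hG]
    change Q.real (Iic a) < Q.real (Iic b)
    linarith
  have hle : ∀ x, G x ≤ 1 := fun x => by
    rw [hG]
    exact measureReal_le_one
  refine ⟨⟨g, hQg, Filter.Eventually.of_forall hgpos⟩,
    continuous_of_monotone_of_le_exp_mul hstrict.monotone hle hη fun y hy x => (hbound y hy x).1,
    hstrict, ?_, hbound⟩
  rw [hQ]
  refine integrable_rpow_abs_map_add_mul hρ η hm ?_
  rw [hμZ]
  exact integrable_rpow_abs_laplace (by linarith)
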